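/- arXiv:1605.02530 — 6 statements merged into one kernel-verified Lean document; each statement's English description precedes it below -/
import Mathlib

section
/- Let (X,d) be a metric space, r > 0, and let H ⊆ X be a geodesic hub set for scale r. Let W = {v ∈ X : d(v,x) > r for all x ∈ H}. Then the relation on W defined by u ~ w if and only if d(u,w) ≤ r is an equivalence relation on W (it is reflexive, symmetric, and transitive). -/
/-- A set `H` is a geodesic hub set for scale `r`: every pair of points at
distance in `(r, 2r]` has a point of `H` on a geodesic between them. -/
def IsGeodesicHubSet {X : Type*} [MetricSpace X] (H : Set X) (r : ℝ) : Prop :=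
  ∀ u w : X, r < dist u w → dist u w ≤ 2 * r →
    ∃ x ∈ H, dist u x + dist x w = dist u w

theorem cluster_relation_is_equivalence {X : Type*} [MetricSpace X]
    (r : ℝ) (hr : 0 < r) (H : Set X) (hH : IsGeodesicHubSet H r)
    (W : Set X) (hW : W = {v : X | ∀ x ∈ H, r < dist v x}) :
    (∀ u ∈ W, dist u u ≤ r) ∧
    (∀ u ∈ W, ∀ w ∈ W, dist u w ≤ r → dist w u ≤ r) ∧
    (∀ u ∈ W, ∀ v ∈ W, ∀ w ∈ W, dist u v ≤ r → dist v w ≤ r → dist u w ≤ r) := by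
  subst hW
  refine ⟨fun u _ => by simpa using hr.le, fun u _ w _ h => by rwa [dist_comm], ?_⟩
  intro u hu v _ w hw huv hvw
  by_contra! h
  obtain ⟨x, hx, hxd⟩ := hH u w h (by linarith [dist_triangle u v w])
  have hux := hu x hx
  have hwx := hw x hx
  rw [dist_comm] at hwx
  linarith [dist_triangle u v w]
end

section
/- Let (X,d) be a metric space, r > 0, and let H ⊆ X be a geodesic hub set for scale r. Let W = {v ∈ X : d(v,x) > r for all x ∈ H}, and call a cluster any maximal subset T ⊆ W such that d(u,w) ≤ r for all u,w ∈ T. If T and T' are distinct clusters, then d(u,w) > 2r for every u ∈ T and every w ∈ T'. -/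
/-- A cluster for `W` and scale `r`: a maximal subset of `W` of diameter at most `r`. -/
def IsCluster {X : Type*} [MetricSpace X] (W : Set X) (r : ℝ) (T : Set X) : Prop :=
  T ⊆ W ∧ (∀ u ∈ T, ∀ w ∈ T, dist u w ≤ r) ∧
    ∀ T' : Set X, T' ⊆ W → (∀ u ∈ T', ∀ w ∈ T', dist u w ≤ r) → T ⊆ T' → T' = T

theorem IsGeodesicHubSet.dist_le_of_dist_le_two_mul {X : Type*} [MetricSpace X] {H : Set X} {r : ℝ}
    (hH : IsGeodesicHubSet H r) {u w : X} (hu : ∀ x ∈ H, r < dist u x)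
    (hw : ∀ x ∈ H, r < dist w x) (huw : dist u w ≤ 2 * r) : dist u w ≤ r := by
  by_contra! h
  obtain ⟨x, hx, hxd⟩ := hH u w h huw
  have hux := hu x hx
  have hwx := hw x hx
  rw [dist_comm w x] at hwx
  linarith

theorem distinct_clusters_far_apart {X : Type*} [MetricSpace X]
    (r : ℝ) (hr : 0 < r) (H : Set X) (hH : IsGeodesicHubSet H r)
    (W : Set X) (hW : W = {v : X | ∀ x ∈ H, r < dist v x})
    (T T' : Set X) (hT : IsCluster W r T) (hT' : IsCluster W r T') (hne : T ≠ T') :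
    ∀ u ∈ T, ∀ w ∈ T', 2 * r < dist u w := by
  subst hW
  intro u hu w hw
  by_contra! huw
  obtain ⟨hTW, hTd, hTmax⟩ := hT
  obtain ⟨hTW', hTd', hTmax'⟩ := hT'
  have huw' := hH.dist_le_of_dist_le_two_mul (hTW hu) (hTW' hw) huw
  have cross : ∀ a ∈ T, ∀ b ∈ T', dist a b ≤ r := by
    intro a ha b hb
    have haw : dist a w ≤ r := hH.dist_le_of_dist_le_two_mul (hTW ha) (hTW' hw) <| by
      linarith [dist_triangle a u w, hTd a ha u hu]
    exact hH.dist_le_of_dist_le_two_mul (hTW ha) (hTW' hb) <| by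
      linarith [dist_triangle a w b, hTd' w hw b hb]
  have hsub := Set.union_subset hTW hTW'
  have hdist : ∀ a ∈ T ∪ T', ∀ b ∈ T ∪ T', dist a b ≤ r := by
    rintro a (ha | ha) b (hb | hb)
    · exact hTd a ha b hb
    · exact cross a ha b hb
    · exact dist_comm a b ▸ cross b hb a ha
    · exact hTd' a ha b hb
  exact hne ((hTmax _ hsub hdist Set.subset_union_left).symm.trans
    (hTmax' _ hsub hdist Set.subset_union_right))
end

section
/- Let (X,d) be a metric space, r > 0, and let H ⊆ X be a geodesic hub set for scale r. Let W = {v ∈ X : d(v,x) > r for all x ∈ H}, and call a cluster any maximal subset T ⊆ W such that d(u,w) ≤ r for all u,w ∈ T. Then every v ∈ W belongs to exactly one cluster, namely the set {u ∈ W : d(u,v) ≤ r}; consequently, every point of X not contained in any cluster is at distance at most r from some point of H. -/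
theorem clusters_partition_far_vertices {X : Type*} [MetricSpace X]
    (r : ℝ) (hr : 0 < r) (H : Set X) (hH : IsGeodesicHubSet H r)
    (W : Set X) (hW : W = {v : X | ∀ x ∈ H, r < dist v x}) :
    (∀ v ∈ W,
      IsCluster W r {u ∈ W | dist u v ≤ r} ∧
      v ∈ {u ∈ W | dist u v ≤ r} ∧
      ∀ T : Set X, IsCluster W r T → v ∈ T → T = {u ∈ W | dist u v ≤ r}) ∧
    (∀ v : X, (∀ T : Set X, IsCluster W r T → v ∉ T) → ∃ x ∈ H, dist v x ≤ r) := by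
  subst hW
  have key : ∀ v ∈ {v : X | ∀ x ∈ H, r < dist v x},
      IsCluster {v : X | ∀ x ∈ H, r < dist v x} r
        {u ∈ {v : X | ∀ x ∈ H, r < dist v x} | dist u v ≤ r} ∧
      v ∈ {u ∈ {v : X | ∀ x ∈ H, r < dist v x} | dist u v ≤ r} := by
    intro v hv
    have hvv : dist v v ≤ r := by simpa using hr.le
    refine ⟨⟨fun u hu => hu.1, ?_, ?_⟩, hv, hvv⟩
    · rintro u ⟨hu, huv⟩ w ⟨hw, hwv⟩
      refine hH.dist_le_of_dist_le_two_mul hu hw ?_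
      linarith [dist_triangle_right u w v]
    · intro T hTW hT hsub
      exact Set.Subset.antisymm (fun u hu => ⟨hTW hu, hT u hu v (hsub ⟨hv, hvv⟩)⟩) hsub
  refine ⟨fun v hv => ⟨(key v hv).1, (key v hv).2, ?_⟩, ?_⟩
  · intro T hT hvT
    have hC := (key v hv).1
    exact (hT.2.2 _ hC.1 hC.2.1 fun u hu => ⟨hT.1 hu, hT.2.1 u hu v hvT⟩).symm
  · intro v hv
    by_contra! h
    exact hv _ (key v h).1 (key v h).2
end

section
/- Let (X,d) be a finite metric space and ρ > 0. Let H₀ ⊆ X be a geodesic hub set for scale ρ/2, let W = {v ∈ X : d(v,y) > ρ/2 for all y ∈ H₀}, and let the clusters be the equivalence classes of W under the relation d(u,w) ≤ ρ/2. Suppose: (i) C* ⊆ X satisfies X = ⋃_{c ∈ C*} B(c,ρ); (ii) C*₁ = C* \ W and H ⊆ H₀ satisfies: for every c ∈ C*₁ there is x ∈ H with d(c,x) ≤ ρ/2; (iii) R₁ = ⋃_{x ∈ H} B(x, 3ρ/2) and 𝒰 is the set of clusters T with T ⊄ R₁; (iv) C₂ ⊆ X satisfies C₂ ∩ T ≠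 ∅ for every T ∈ 𝒰; (v) C*₂ is the set of c ∈ C* lying in some cluster of 𝒰, and C*₃ = C* \ (C*₁ ∪ C*₂); (vi) H' = {y ∈ H₀ \ H : there is c ∈ C*₃ with d(y,c) ≤ ρ}, and C₃ ⊆ X satisfies: for every y ∈ H' there is v ∈ C₃ with d(y,v) ≤ ρ. Then X = ⋃_{v ∈ H ∪ C₂ ∪ C₃} B(v, 3ρ/2), i.e., every point of X is within distance 3ρ/2 of some point of H ∪ C₂ ∪ C₃. -/
/-- Two points at distance greater than `r` from every hub and at most `2 * r` from each other
are within distance `r`. -/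
theorem IsGeodesicHubSet.dist_le_of_far {X : Type*} [MetricSpace X] {H : Set X} {r : ℝ}
    (hH : IsGeodesicHubSet H r) {u w : X} (hu : ∀ y ∈ H, r < dist u y)
    (hw : ∀ y ∈ H, r < dist w y) (huw : dist u w ≤ 2 * r) : dist u w ≤ r := by
  by_contra! h
  obtain ⟨x, hx, hxe⟩ := hH u w h huw
  have h₁ := hu x hx
  have h₂ := hw x hx
  rw [dist_comm w x] at h₂
  linarith

theorem covering_correctness {X : Type*} [MetricSpace X] [Finite X]
    (ρ : ℝ) (hρ : 0 < ρ)
    (H₀ : Set X) (hH₀ : IsGeodesicHubSet H₀ (ρ / 2))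
    (W : Set X) (hW : W = {v : X | ∀ y ∈ H₀, ρ / 2 < dist v y})
    -- the clusters: equivalence classes of `W` under the relation `dist u w ≤ ρ/2`
    (𝒯 : Set (Set X)) (h𝒯 : 𝒯 = {T : Set X | ∃ v ∈ W, T = {u ∈ W | dist u v ≤ ρ / 2}})
    -- (i) the optimum solution C* covers X with balls of radius ρ
    (Cstar : Set X) (hCstar : ∀ v : X, ∃ c ∈ Cstar, dist v c ≤ ρ)
    -- (ii) C*₁ is the set of non-cluster optimum centers; H covers them at distance ρ/2
    (Cstar₁ : Set X) (hCstar₁ : Cstar₁ = Cstar \ W)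
    (H : Set X) (hHsub : H ⊆ H₀)
    (hH : ∀ c ∈ Cstar₁, ∃ x ∈ H, dist c x ≤ ρ / 2)
    -- (iii) R₁ is the region covered by balls of radius 3ρ/2 around H,
    -- and 𝒰 is the set of clusters not contained in R₁
    (R₁ : Set X) (hR₁ : R₁ = {v : X | ∃ x ∈ H, dist v x ≤ 3 * ρ / 2})
    (𝒰 : Set (Set X)) (h𝒰 : 𝒰 = {T ∈ 𝒯 | ¬ T ⊆ R₁})
    -- (iv) C₂ meets every cluster of 𝒰
    (C₂ : Set X) (hC₂ : ∀ T ∈ 𝒰, (C₂ ∩ T).Nonempty)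
    -- (v) C*₂ are the optimum centers lying in clusters of 𝒰, C*₃ the rest
    (Cstar₂ : Set X) (hCstar₂ : Cstar₂ = {c ∈ Cstar | ∃ T ∈ 𝒰, c ∈ T})
    (Cstar₃ : Set X) (hCstar₃ : Cstar₃ = Cstar \ (Cstar₁ ∪ Cstar₂))
    -- (vi) H' are the hubs outside H at distance at most ρ from C*₃,
    -- and C₃ covers them with balls of radius ρ
    (H' : Set X) (hH' : H' = {y ∈ H₀ \ H | ∃ c ∈ Cstar₃, dist y c ≤ ρ})
    (C₃ : Set X) (hC₃ : ∀ y ∈ H', ∃ v ∈ C₃, dist y v ≤ ρ) :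
    ∀ u : X, ∃ v ∈ H ∪ C₂ ∪ C₃, dist u v ≤ 3 * ρ / 2 := by
  subst hW h𝒯 hCstar₁ hR₁ h𝒰 hCstar₂ hCstar₃ hH'
  intro u
  obtain ⟨c, hc, huc⟩ := hCstar u
  by_cases hcW : ∀ y ∈ H₀, ρ / 2 < dist c y
  swap
  · obtain ⟨x, hx, hcx⟩ := hH c ⟨hc, hcW⟩
    exact ⟨x, .inl (.inl hx), by linarith [dist_triangle u c x]⟩
  by_cases hcU : ∃ T ∈ {T ∈ {T : Set X | ∃ v ∈ {v : X | ∀ y ∈ H₀, ρ / 2 < dist v y},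
      T = {u ∈ {v : X | ∀ y ∈ H₀, ρ / 2 < dist v y} | dist u v ≤ ρ / 2}} |
      ¬ T ⊆ {v : X | ∃ x ∈ H, dist v x ≤ 3 * ρ / 2}}, c ∈ T
  · obtain ⟨T, hT, hcT⟩ := hcU
    obtain ⟨z, hz, hzT⟩ := hC₂ T hT
    obtain ⟨⟨v, -, rfl⟩, -⟩ := hT
    have hcz : dist c z ≤ ρ / 2 := hH₀.dist_le_of_far hcW hzT.1
      (by linarith [dist_triangle_right c z v, hcT.2, hzT.2])
    exact ⟨z, .inl (.inr hz), by linarith [dist_triangle u c z]⟩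
  -- a hub close to both `u` and `c` suffices
  have key : ∀ y ∈ H₀, dist u y ≤ ρ / 2 → dist y c ≤ ρ →
      ∃ v ∈ H ∪ C₂ ∪ C₃, dist u v ≤ 3 * ρ / 2 := by
    intro y hy huy hyc
    by_cases hyH : y ∈ H
    · exact ⟨y, .inl (.inl hyH), by linarith⟩
    · obtain ⟨v, hv, hyv⟩ := hC₃ y ⟨⟨hy, hyH⟩, c,
        ⟨hc, fun h => h.elim (fun h => h.2 hcW) (fun h => hcU h.2)⟩, hyc⟩
      exact ⟨v, .inr hv, by linarith [dist_triangle u y v]⟩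
  by_cases hd : dist u c ≤ ρ / 2
  · by_cases huW : ∀ y ∈ H₀, ρ / 2 < dist u y
    · by_contra! hu
      refine hcU ⟨_, ⟨⟨c, hcW, rfl⟩, fun hsub => ?_⟩, hcW, by rw [dist_self]; linarith⟩
      obtain ⟨x, hx, hux⟩ := hsub ⟨huW, hd⟩
      exact (hu x (.inl (.inl hx))).not_ge hux
    · push Not at huW
      obtain ⟨y, hy, huy⟩ := huW
      exact key y hy huy (by linarith [dist_triangle_left y c u])
  · obtain ⟨y, hy, hyc⟩ := hH₀ u c (not_le.mp hd) (by linarith)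
    have hcy := hcW y hy
    rw [dist_comm c y] at hcy
    exact key y hy (by linarith) (by linarith [dist_nonneg (x := u) (y := y)])
end

section
/- Let G be a connected simple graph on a finite vertex set and let D be a dominating set of G (every vertex lies in D or is adjacent to a vertex of D) with |D| ≥ 2. Then there exists u ∈ D such that every vertex w of G is at graph distance at most 4 from some vertex of D \ {u}. -/
/-- In a connected graph, every vertex `a` of a dominating set with another vertex `b` has
another vertex of the dominating set at distance at most three. -/
theorem SimpleGraph.Connected.exists_dominating_dist_le_three {V : Type*} {G : SimpleGraph V}
    (hconn : G.Connected) {D : Set V} (hdom : ∀ v, ∃ u ∈ D, G.dist v u ≤ 1)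
    {a b : V} (hb : b ∈ D) (hab : b ≠ a) :
    ∃ y ∈ D, y ≠ a ∧ G.dist a y ≤ 3 := by
  by_cases hbS : G.dist b a ≤ 1
  · exact ⟨b, hb, hab, by rw [SimpleGraph.dist_comm]; omega⟩
  · obtain ⟨p⟩ := hconn.preconnected a b
    obtain ⟨d, -, hs, ht⟩ := p.exists_boundary_dart {v | G.dist v a ≤ 1} (by simp) hbS
    obtain ⟨y, hy, hty⟩ := hdom d.snd
    refine ⟨y, hy, fun h => ht (h ▸ hty), ?_⟩
    have hst : G.dist d.fst d.snd = 1 := SimpleGraph.dist_eq_one_iff_adj.mpr d.adj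
    have hsa : G.dist d.fst a ≤ 1 := hs
    have h₁ := hconn.dist_triangle (u := a) (v := d.fst) (w := y)
    have h₂ := hconn.dist_triangle (u := d.fst) (v := d.snd) (w := y)
    rw [SimpleGraph.dist_comm] at hsa
    omega

theorem remove_one_center_cost_four {V : Type*} [Fintype V]
    (G : SimpleGraph V) (hconn : G.Connected)
    (D : Set V)
    (hdom : ∀ v : V, v ∈ D ∨ ∃ u ∈ D, G.Adj v u)
    (hcard : 2 ≤ D.ncard) :
    ∃ u ∈ D, ∀ w : V, ∃ x ∈ D \ {u}, G.dist w x ≤ 4 := by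
  have hdist : ∀ v, ∃ u ∈ D, G.dist v u ≤ 1 := by
    intro v
    rcases hdom v with hv | ⟨u, hu, hvu⟩
    · exact ⟨v, hv, by simp⟩
    · exact ⟨u, hu, (SimpleGraph.dist_eq_one_iff_adj.mpr hvu).le⟩
  obtain ⟨b, hb, a, ha, hab⟩ := (Set.one_lt_ncard (Set.toFinite D)).mp hcard
  obtain ⟨y, hy, hya, hay⟩ := hconn.exists_dominating_dist_le_three hdist hb hab
  refine ⟨a, ha, fun w => ?_⟩
  obtain ⟨z, hz, hwz⟩ := hdist w
  by_cases hza : z = a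
  · subst hza
    have h := hconn.dist_triangle (u := w) (v := z) (w := y)
    exact ⟨y, ⟨hy, hya⟩, by omega⟩
  · exact ⟨z, ⟨hz, hza⟩, by omega⟩
end

section
/- Let G be a simple graph, S a vertex cover of G, D a dominating set of G, D₁ = D ∩ S, and D₂ = {v ∉ S : no neighbor of v lies in D₁}. Then every vertex v that is neither in D₁ ∪ D₂ nor adjacent to any vertex of D₁ ∪ D₂ lies in S and is adjacent to some vertex of D \ S. -/
theorem remaining_vertices_dominated_from_outside_cover {V : Type*}
    (G : SimpleGraph V)
    (S : Set V) (hS : ∀ u v : V, G.Adj u v → u ∈ S ∨ v ∈ S)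
    (D : Set V) (hD : ∀ v : V, v ∈ D ∨ ∃ u ∈ D, G.Adj v u)
    (D₁ : Set V) (hD₁ : D₁ = D ∩ S)
    (D₂ : Set V) (hD₂ : D₂ = {v : V | v ∉ S ∧ ∀ u ∈ D₁, ¬ G.Adj v u}) :
    ∀ v : V, v ∉ D₁ ∪ D₂ → (∀ u ∈ D₁ ∪ D₂, ¬ G.Adj v u) →
      v ∈ S ∧ ∃ u ∈ D \ S, G.Adj v u := by
  subst hD₁ hD₂
  intro v hv hadj
  have hvS : v ∈ S := by
    by_contra h
    exact hv (Or.inr ⟨h, fun u hu => hadj u (Or.inl hu)⟩)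
  obtain h | ⟨u, huD, hvu⟩ := hD v
  · exact absurd (Or.inl ⟨h, hvS⟩) hv
  · exact ⟨hvS, u, ⟨huD, fun huS => hadj u (Or.inl ⟨huD, huS⟩) hvu⟩, hvu⟩
end
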